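/- Fix an integer k ≥ 1. As n → ∞, the proportion of doubly rooted trees (T, r, t) on the vertex set {1, …, n} whose root component has exactly k vertices, among all (n−1)·n^{n−1} doubly rooted trees, converges to (k^{k−1}/k!) · e^{−k}. -/

import Mathlib

section ParentFunctions

open Function

variable {V : Type*}

/-- `p` is the parent function of a forest whose set of roots is `R`: the roots are fixed and
every vertex is eventually sent to a root. -/
def IsParentFun (R : Finset V) (p : V → V) : Prop :=
  (∀ x ∈ R, p x = x) ∧ ∀ x, ∃ m, p^[m] x ∈ R

theorem iterate_eq_of_le {p : V → V} {x w : V} {m l : ℕ} (hw : p w = w) (h : p^[m] x = w)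
    (hml : m ≤ l) : p^[l] x = w := by
  obtain ⟨d, rfl⟩ := Nat.exists_eq_add_of_le' hml
  rw [iterate_add_apply, h, iterate_fixed hw]

/-- A periodic point which is eventually sent to a fixed point is that fixed point. -/
theorem eq_of_periodic_of_iterate_eq {p : V → V} {v w : V} {j m : ℕ} (hj : p^[j + 1] v = v)
    (hw : p w = w) (h : p^[m] v = w) : v = w := by
  have h₁ : p^[(j + 1) * m] v = v := by rw [iterate_mul, iterate_fixed hj]
  rw [← h₁]
  exact iterate_eq_of_le hw h (Nat.le_mul_of_pos_left _ (Nat.succ_pos j))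

theorem iterate_update_mem [DecidableEq V] {p : V → V} {S : Set V} {v u : V} (hv : v ∈ S)
    (m : ℕ) (x : V) (h : p^[m] x ∈ S) : ∃ l, (update p v u)^[l] x ∈ S := by
  induction m generalizing x with
  | zero => exact ⟨0, h⟩
  | succ m ih =>
    by_cases hx : x = v
    · exact ⟨0, hx ▸ hv⟩
    · obtain ⟨l, hl⟩ := ih (p x) h
      exact ⟨l + 1, by rwa [iterate_succ_apply, update_of_ne hx]⟩

theorem IsParentFun.update_root [DecidableEq V] {R : Finset V} {p : V → V} (hp : IsParentFun R p)
    (v : V) : IsParentFun (insert v R) (update p v v) := by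
  refine ⟨fun x hx => ?_, fun x => ?_⟩
  · by_cases hxv : x = v
    · simp [hxv]
    · rw [update_of_ne hxv]
      exact hp.1 x (Finset.mem_of_mem_insert_of_ne hx hxv)
  · obtain ⟨m, hm⟩ := hp.2 x
    exact iterate_update_mem (S := {y | y ∈ insert v R}) (Finset.mem_insert_self v R) m x
      (Finset.mem_insert_of_mem hm)

theorem IsParentFun.iterate_update_ne [DecidableEq V] {R : Finset V} {p : V → V}
    (hp : IsParentFun R p) {v : V} (hv : v ∉ R) (m : ℕ) : (update p v v)^[m] (p v) ≠ v := by
  intro h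
  obtain ⟨l, hl⟩ := iterate_update_mem (S := {v}) (u := p v) rfl m (p v) h
  rw [update_idem, update_eq_self, Set.mem_singleton_iff, ← iterate_succ_apply] at hl
  obtain ⟨i, hi⟩ := hp.2 v
  exact hv (eq_of_periodic_of_iterate_eq hl (hp.1 _ hi) rfl ▸ hi)

theorem IsParentFun.update_of_not_iterate [DecidableEq V] {R : Finset V} {q : V → V} {v u : V}
    (hq : IsParentFun (insert v R) q) (hv : v ∉ R) (hu : ∀ m, q^[m] u ≠ v) :
    IsParentFun R (update q v u) := by
  have key : ∀ (m : ℕ) (x : V), q^[m] x ∈ R → ∃ l, (update q v u)^[l] x ∈ R := by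
    intro m
    induction m with
    | zero => exact fun x hx => ⟨0, hx⟩
    | succ m ih =>
      intro x hx
      by_cases hxv : x = v
      · rw [hxv, iterate_fixed (hq.1 v (Finset.mem_insert_self _ _))] at hx
        exact absurd hx hv
      · obtain ⟨l, hl⟩ := ih (q x) hx
        exact ⟨l + 1, by rwa [iterate_succ_apply, update_of_ne hxv]⟩
  obtain ⟨l, hl⟩ : ∃ l, (update q v u)^[l] u ∈ R := by
    obtain ⟨m, hm⟩ := hq.2 u
    exact key m u (Finset.mem_of_mem_insert_of_ne hm (hu m))
  refine ⟨fun x hx => ?_, fun x => ?_⟩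
  · rw [update_of_ne (ne_of_mem_of_not_mem hx hv)]
    exact hq.1 x (Finset.mem_insert_of_mem hx)
  · obtain ⟨m, hm⟩ := hq.2 x
    rcases Finset.mem_insert.1 hm with h | h
    · obtain ⟨i, hi⟩ := iterate_update_mem (S := {v}) (u := u) rfl m x h
      rw [Set.mem_singleton_iff] at hi
      refine ⟨l + (1 + i), ?_⟩
      rw [iterate_add_apply, iterate_add_apply, hi, iterate_one, Function.update_self]
      exact hl
    · exact key m x h

/-- Cutting the edge above `v` makes `v` a new root; the parent of `v` is any vertex outside the
new component of `v`. -/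
def parentFunCutEquiv [DecidableEq V] {R : Finset V} {v : V} (hv : v ∉ R) :
    {p : V → V // IsParentFun R p} ≃
      {s : (V → V) × V // IsParentFun (insert v R) s.1 ∧ ∀ m, s.1^[m] s.2 ≠ v} where
  toFun p := ⟨(update p.1 v v, p.1 v), p.2.update_root v, p.2.iterate_update_ne hv⟩
  invFun s := ⟨update s.1.1 v s.1.2, s.2.1.update_of_not_iterate hv s.2.2⟩
  left_inv p := by simp
  right_inv := by
    rintro ⟨⟨q, u⟩, hq, hu⟩
    have : q v = v := hq.1 v (Finset.mem_insert_self _ _)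
    ext x
    · simp only [update_idem]
      by_cases hx : x = v
      · simp [hx, this]
      · simp [hx]
    · simp

theorem IsParentFun.existsUnique_root {R : Finset V} {q : V → V} (hq : IsParentFun R q) (u : V) :
    ∃! w, w ∈ R ∧ ∃ m, q^[m] u = w := by
  obtain ⟨m, hm⟩ := hq.2 u
  refine ⟨q^[m] u, ⟨hm, m, rfl⟩, ?_⟩
  rintro w ⟨hw, l, hl⟩
  rcases le_total m l with h | h
  · rw [← hl]; exact iterate_eq_of_le (hq.1 _ hm) rfl h
  · exact (iterate_eq_of_le (hq.1 _ hw) hl h).symm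

theorem conj_iterate_apply {W : Type*} (e : V ≃ W) (q : V → V) (m : ℕ) (x : V) :
    (e.conj q)^[m] (e x) = e (q^[m] x) :=
  ((Semiconj.iterate_right (f := e) (ga := q) (gb := e.conj q) (fun y => by simp) m) x).symm

theorem IsParentFun.conj {W : Type*} (e : V ≃ W) {R : Finset V} {S : Finset W}
    (hRS : ∀ x, e x ∈ S ↔ x ∈ R) (q : V → V) :
    IsParentFun S (e.conj q) ↔ IsParentFun R q := by
  unfold IsParentFun
  simp only [← e.forall_congr_right (q := fun x => ∃ m, (e.conj q)^[m] x ∈ S),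
    ← e.forall_congr_right (q := fun x => x ∈ S → e.conj q x = x), conj_iterate_apply, hRS]
  simp

theorem sum_card_parentFun_iterate [Fintype V] (R : Finset V) :
    ∑ w ∈ R, Nat.card {s : (V → V) × V // IsParentFun R s.1 ∧ ∃ m, s.1^[m] s.2 = w} =
      Nat.card {p : V → V // IsParentFun R p} * Fintype.card V := by
  classical
  have h := Finset.sum_card_bipartiteAbove_eq_sum_card_bipartiteBelow
    (s := R) (t := Finset.univ.filter fun s : (V → V) × V => IsParentFun R s.1)
    (fun w s => ∃ m, s.1^[m] s.2 = w)
  have hone : ∀ s ∈ Finset.univ.filter fun s : (V → V) × V => IsParentFun R s.1,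
      (R.bipartiteBelow (fun w (s : (V → V) × V) => ∃ m, s.1^[m] s.2 = w) s).card = 1 := by
    intro s hs
    obtain ⟨w, hw, hw'⟩ := (Finset.mem_filter.1 hs).2.existsUnique_root s.2
    refine Finset.card_eq_one.2 ⟨w, Finset.eq_singleton_iff_unique_mem.2
      ⟨(Finset.mem_bipartiteBelow _).2 hw, fun y hy => hw' y ((Finset.mem_bipartiteBelow _).1 hy)⟩⟩
  rw [Finset.sum_congr rfl hone, Finset.sum_const, smul_eq_mul, mul_one] at h
  have hprod : (Finset.univ.filter fun s : (V → V) × V => IsParentFun R s.1) =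
      (Finset.univ.filter fun p : V → V => IsParentFun R p) ×ˢ Finset.univ := by
    ext s; simp
  rw [hprod, Finset.card_product, Finset.card_univ] at h
  rw [Nat.card_eq_fintype_card, Fintype.card_subtype, ← h]
  refine Finset.sum_congr rfl fun w _ => ?_
  rw [Nat.card_eq_fintype_card, Fintype.card_subtype, Finset.bipartiteAbove, ← hprod,
    Finset.filter_filter]

/-- The number of parent functions with root set `R` and a marked vertex in the component of
`w ∈ R` does not depend on `w`. -/
theorem card_parentFun_iterate_eq {R : Finset V} {v w : V} (hv : v ∈ R) (hw : w ∈ R) :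
    Nat.card {s : (V → V) × V // IsParentFun R s.1 ∧ ∃ m, s.1^[m] s.2 = v} =
      Nat.card {s : (V → V) × V // IsParentFun R s.1 ∧ ∃ m, s.1^[m] s.2 = w} := by
  classical
  have hR : ∀ x, Equiv.swap v w x ∈ R ↔ x ∈ R := by
    intro x
    rw [Equiv.swap_apply_def]
    split_ifs <;> simp_all
  refine Nat.card_congr (Equiv.subtypeEquiv
    ((Equiv.swap v w).conj.prodCongr (Equiv.swap v w)) ?_)
  rintro ⟨q, u⟩
  refine and_congr (IsParentFun.conj _ hR q).symm (exists_congr fun m => ?_)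
  simp only [Equiv.prodCongr_apply, Prod.map_apply]
  rw [conj_iterate_apply, ← Equiv.eq_symm_apply]
  simp

theorem card_parentFun_insert [Fintype V] [DecidableEq V] {R : Finset V} {v : V} (hv : v ∉ R) :
    (R.card + 1) * Nat.card {p : V → V // IsParentFun R p} =
      R.card * Fintype.card V * Nat.card {p : V → V // IsParentFun (insert v R) p} := by
  have h₁ := sum_card_parentFun_iterate (insert v R)
  rw [Finset.sum_congr rfl fun w hw =>
    card_parentFun_iterate_eq hw (Finset.mem_insert_self v R), Finset.sum_const,
    Finset.card_insert_of_notMem hv, smul_eq_mul] at h₁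
  have h₂ : Nat.card {p : V → V // IsParentFun R p} +
      Nat.card {s : (V → V) × V // IsParentFun (insert v R) s.1 ∧ ∃ m, s.1^[m] s.2 = v} =
      Nat.card {p : V → V // IsParentFun (insert v R) p} * Fintype.card V := by
    classical
    rw [Nat.card_congr (parentFunCutEquiv hv), add_comm]
    simp only [Nat.card_eq_fintype_card, Fintype.card_subtype, ← not_exists]
    rw [← Finset.filter_filter, ← Finset.filter_filter, Finset.card_filter_add_card_filter_not,
      ← Finset.card_univ, ← Finset.card_product]
    congr 1
    ext s; simp
  nlinarith

/-- **Cayley's formula** for rooted forests with `R.card` prescribed roots. -/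
theorem card_parentFun_mul [Fintype V] [Nonempty V] (R : Finset V) :
    Nat.card {p : V → V // IsParentFun R p} * Fintype.card V =
      R.card * Fintype.card V ^ (Fintype.card V - R.card) := by
  classical
  induction hd : Fintype.card V - R.card generalizing R with
  | zero =>
    have hR : R = Finset.univ := by
      rw [← Finset.card_eq_iff_eq_univ]
      have := R.card_le_univ
      omega
    subst hR
    have : Nat.card {p : V → V // IsParentFun Finset.univ p} = 1 := by
      rw [Nat.card_eq_one_iff_unique]
      refine ⟨⟨fun p q => Subtype.ext (funext fun x => ?_)⟩, ⟨id, fun _ _ => rfl, fun x =>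
        ⟨0, Finset.mem_univ _⟩⟩⟩
      rw [p.2.1 x (Finset.mem_univ x), q.2.1 x (Finset.mem_univ x)]
    rw [this]
    simp
  | succ d ih =>
    obtain ⟨v, hv⟩ : ∃ v, v ∉ R := by
      by_contra! h
      rw [Finset.eq_univ_iff_forall.2 h, Finset.card_univ] at hd
      omega
    have h₁ := card_parentFun_insert hv
    have h₂ := ih (insert v R) (by rw [Finset.card_insert_of_notMem hv]; omega)
    rw [Finset.card_insert_of_notMem hv] at h₂
    refine Nat.eq_of_mul_eq_mul_left (Nat.add_one_pos R.card) ?_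
    calc (R.card + 1) * (Nat.card {p : V → V // IsParentFun R p} * Fintype.card V)
        = (R.card * Fintype.card V) *
          (Nat.card {p : V → V // IsParentFun (insert v R) p} * Fintype.card V) := by
          rw [← mul_assoc, h₁]; ring
      _ = _ := by rw [h₂]; ring

/-- **Cayley's formula**: there are `n ^ (n - 1)` rooted trees on `n` labelled vertices. -/
theorem card_rootedTree [Fintype V] [Nonempty V] :
    Nat.card {s : (V → V) × V // IsParentFun {s.2} s.1} =
      Fintype.card V ^ (Fintype.card V - 1) := by
  classical
  have e : {s : (V → V) × V // IsParentFun {s.2} s.1} ≃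
      Σ t : V, {p : V → V // IsParentFun {t} p} :=
    ((Equiv.prodComm _ _).subtypeEquiv fun _ => Iff.rfl).trans
      (Equiv.subtypeProdEquivSigmaSubtype fun t p => IsParentFun {t} p)
  rw [Nat.card_congr e, Nat.card_sigma]
  refine Nat.eq_of_mul_eq_mul_right (Fintype.card_pos (α := V)) ?_
  rw [Finset.sum_mul, Finset.sum_congr rfl fun t _ => card_parentFun_mul {t}]
  simp [mul_comm]

end ParentFunctions
section Descendants

open Function Sum

/-- `p` is the parent function of a tree with root `t`, and `D` is the set of descendants of the
vertex `r ≠ t`. -/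
def IsDescendantSet {V : Type*} (D : Set V) (s : (V → V) × V × V) : Prop :=
  IsParentFun {s.2.2} s.1 ∧ s.2.1 ≠ s.2.2 ∧ {x | ∃ m, s.1^[m] x = s.2.1} = D

variable {A B : Type*}

/-- Attach a tree on `A` with root `r` below the vertex `u` of a tree on `B`. -/
def glueParentFun [DecidableEq A] (p : A → A) (r : A) (q : B → B) (u : B) : A ⊕ B → A ⊕ B :=
  Sum.elim (fun a => if a = r then inr u else inl (p a)) (fun b => inr (q b))

theorem glueParentFun_iterate_inr [DecidableEq A] (p : A → A) (r : A) (q : B → B) (u : B) (m : ℕ)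
    (b : B) : (glueParentFun p r q u)^[m] (inr b) = inr (q^[m] b) :=
  ((Semiconj.iterate_right (f := inr) (ga := q) (gb := glueParentFun p r q u)
    (fun _ => rfl) m) b).symm

theorem exists_glueParentFun_iterate_inl [DecidableEq A] {p : A → A} {r : A} {q : B → B} {u : B}
    (m : ℕ) (a : A) (h : p^[m] a = r) : ∃ l, (glueParentFun p r q u)^[l] (inl a) = inl r := by
  induction m generalizing a with
  | zero => exact ⟨0, congrArg inl h⟩
  | succ m ih =>
    by_cases ha : a = r
    · exact ⟨0, congrArg inl ha⟩
    · obtain ⟨l, hl⟩ := ih (p a) h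
      exact ⟨l + 1, by simpa [glueParentFun, ha] using hl⟩

theorem exists_iterate_of_glueParentFun_iterate_inl [DecidableEq A] {p : A → A} {r : A} {q : B → B}
    {u : B} (m : ℕ) (a : A) (h : (glueParentFun p r q u)^[m] (inl a) = inl r) :
    ∃ l, p^[l] a = r := by
  induction m generalizing a with
  | zero => exact ⟨0, inl_injective h⟩
  | succ m ih =>
    by_cases ha : a = r
    · exact ⟨0, ha⟩
    · obtain ⟨l, hl⟩ := ih (p a) (by simpa [glueParentFun, ha] using h)
      exact ⟨l + 1, hl⟩

theorem isDescendantSet_glueParentFun [DecidableEq A] {p : A → A} {r : A} {q : B → B} {t : B}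
    (hp : IsParentFun {r} p) (hq : IsParentFun {t} q) (u : B) :
    IsDescendantSet (Set.range inl) (glueParentFun p r q u, inl r, inr t) := by
  simp only [IsParentFun, Finset.mem_singleton, forall_eq] at hp hq
  have hl : ∀ a, ∃ l, (glueParentFun p r q u)^[l] (inl a) = inl r := fun a => by
    obtain ⟨m, hm⟩ := hp.2 a
    exact exists_glueParentFun_iterate_inl m a hm
  refine ⟨⟨?_, ?_⟩, inl_ne_inr, ?_⟩
  · simp [glueParentFun, hq.1]
  · simp only [Finset.mem_singleton]
    rintro (a | b)
    · obtain ⟨l, hl⟩ := hl a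
      obtain ⟨m, hm⟩ := hq.2 u
      refine ⟨m + (1 + l), ?_⟩
      rw [iterate_add_apply, iterate_add_apply, hl, iterate_one,
        show glueParentFun p r q u (inl r) = inr u by simp [glueParentFun],
        glueParentFun_iterate_inr, hm]
    · obtain ⟨m, hm⟩ := hq.2 b
      exact ⟨m, by rw [glueParentFun_iterate_inr, hm]⟩
  · ext (a | b)
    · simpa using hl a
    · simp [glueParentFun_iterate_inr]

theorem exists_glueParentFun_eq [DecidableEq A] {s : (A ⊕ B → A ⊕ B) × (A ⊕ B) × (A ⊕ B)}
    (hs : IsDescendantSet (Set.range inl) s) : ∃ p r q t u,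
      IsParentFun {r} p ∧ IsParentFun {t} q ∧ s = (glueParentFun p r q u, inl r, inr t) := by
  obtain ⟨f, r₀, t₀⟩ := s
  obtain ⟨⟨ht, hreach⟩, hne, hD⟩ := hs
  simp only [Finset.mem_singleton, forall_eq] at ht hreach hne hD
  have hl : ∀ a, ∃ m, f^[m] (inl a) = r₀ := fun a => (Set.ext_iff.1 hD (inl a)).2 ⟨a, rfl⟩
  have hr : ∀ b m, f^[m] (inr b) ≠ r₀ := fun b m h => by
    simpa using (Set.ext_iff.1 hD (inr b)).1 ⟨m, h⟩
  obtain ⟨r, rfl⟩ : ∃ r, inl r = r₀ := (Set.ext_iff.1 hD r₀).1 ⟨0, rfl⟩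
  obtain ⟨t, rfl⟩ : ∃ t, inr t = t₀ := by
    rcases t₀ with a | b
    · obtain ⟨m, hm⟩ := hl a
      rw [iterate_fixed ht] at hm
      exact absurd hm.symm hne
    · exact ⟨b, rfl⟩
  obtain ⟨u, hu⟩ : ∃ u, f (inl r) = inr u := by
    rcases h : f (inl r) with a | b
    · obtain ⟨m, hm⟩ := hl a
      obtain ⟨i, hi⟩ := hreach (inl r)
      rw [← h, ← iterate_succ_apply] at hm
      exact absurd (eq_of_periodic_of_iterate_eq hm ht hi) hne
    · exact ⟨b, rfl⟩
  have hA : ∀ a, ∃ a', if a = r then a' = r else f (inl a) = inl a' := fun a => by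
    by_cases ha : a = r
    · exact ⟨r, by simp [ha]⟩
    · obtain ⟨m, hm⟩ := hl a
      rcases m with _ | m
      · exact absurd (inl_injective hm) ha
      · rcases h : f (inl a) with a' | b
        · exact ⟨a', by simp [ha]⟩
        · rw [iterate_succ_apply, h] at hm
          exact absurd hm (hr b m)
  have hB : ∀ b, ∃ b', f (inr b) = inr b' := fun b => by
    rcases h : f (inr b) with a | b'
    · obtain ⟨m, hm⟩ := hl a
      exact absurd (by rwa [iterate_succ_apply, h]) (hr b (m + 1))
    · exact ⟨b', rfl⟩
  choose p hp using hA
  choose q hq using hB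
  have hf : f = glueParentFun p r q u := by
    funext x
    rcases x with a | b
    · have := hp a
      by_cases ha : a = r
      · simp [glueParentFun, ha, hu]
      · simpa [glueParentFun, ha] using this
    · exact hq b
  subst hf
  refine ⟨p, r, q, t, u, ⟨?_, fun a => ?_⟩, ⟨?_, fun b => ?_⟩, rfl⟩
  · simpa using hp r
  · obtain ⟨m, hm⟩ := hl a
    simpa using exists_iterate_of_glueParentFun_iterate_inl m a hm
  · simpa [glueParentFun] using ht
  · obtain ⟨m, hm⟩ := hreach (inr b)
    exact ⟨m, by simpa [glueParentFun_iterate_inr] using hm⟩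

theorem card_isDescendantSet_sum :
    Nat.card {s : (A ⊕ B → A ⊕ B) × (A ⊕ B) × (A ⊕ B) // IsDescendantSet (Set.range inl) s} =
      Nat.card {s : (A → A) × A // IsParentFun {s.2} s.1} *
        (Nat.card {s : (B → B) × B // IsParentFun {s.2} s.1} * Nat.card B) := by
  classical
  rw [← Nat.card_prod, ← Nat.card_prod]
  refine (Nat.card_eq_of_bijective (fun x => ⟨(glueParentFun x.1.1.1 x.1.1.2 x.2.1.1.1 x.2.2,
    inl x.1.1.2, inr x.2.1.1.2), isDescendantSet_glueParentFun x.1.2 x.2.1.2 x.2.2⟩)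
    ⟨?_, ?_⟩).symm
  · rintro ⟨⟨⟨p, r⟩, hp⟩, ⟨⟨q, t⟩, hq⟩, u⟩ ⟨⟨⟨p', r'⟩, hp'⟩, ⟨⟨q', t'⟩, hq'⟩, u'⟩ h
    simp only [Subtype.mk.injEq, Prod.mk.injEq, inl.injEq, inr.injEq] at h
    obtain ⟨hf, rfl, rfl⟩ := h
    have hu : u = u' := by simpa [glueParentFun] using congrFun hf (inl r)
    have hqq : q = q' := funext fun b => by simpa [glueParentFun] using congrFun hf (inr b)
    have hpp : p = p' := funext fun a => by
      by_cases ha : a = r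
      · exact ha ▸ (hp.1 r (Finset.mem_singleton_self r)).trans
          (hp'.1 r (Finset.mem_singleton_self r)).symm
      · simpa [glueParentFun, ha] using congrFun hf (inl a)
    subst hu hqq hpp
    rfl
  · rintro ⟨s, hs⟩
    obtain ⟨p, r, q, t, u, hp, hq, rfl⟩ := exists_glueParentFun_eq hs
    exact ⟨(⟨(p, r), hp⟩, ⟨(q, t), hq⟩, u), rfl⟩

theorem IsDescendantSet.conj {V W : Type*} (e : V ≃ W) (D : Set V) (s : (V → V) × V × V) :
    IsDescendantSet (e '' D) (e.conj s.1, e s.2.1, e s.2.2) ↔ IsDescendantSet D s := by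
  unfold IsDescendantSet
  refine and_congr (IsParentFun.conj e (by simp) s.1) (and_congr e.injective.ne_iff ?_)
  rw [← (Set.image_injective.2 e.injective).eq_iff (a := {x | ∃ m, s.1^[m] x = s.2.1})]
  refine Eq.congr_left (Set.ext fun y => ?_)
  obtain ⟨x, rfl⟩ := e.surjective y
  simp [conj_iterate_apply]

theorem card_isDescendantSet {V : Type*} [Fintype V] {D : Finset V} (hD : D.Nonempty)
    (hD' : D.card < Fintype.card V) :
    Nat.card {s : (V → V) × V × V // IsDescendantSet (D : Set V) s} =
      D.card ^ (D.card - 1) * (Fintype.card V - D.card) ^ (Fintype.card V - D.card) := by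
  classical
  let e : {x // x ∈ D} ⊕ {x // x ∉ D} ≃ V := Equiv.sumCompl (· ∈ D)
  have he : e '' Set.range inl = D := by
    rw [← Set.range_comp]
    exact Subtype.range_coe
  have hc : Fintype.card {x // x ∉ D} = Fintype.card V - D.card := by
    rw [Fintype.card_subtype_compl, Fintype.card_coe]
  have : Nonempty {x // x ∈ D} := hD.to_subtype
  have : Nonempty {x // x ∉ D} := Fintype.card_pos_iff.1 (by omega)
  have h : Nat.card {s : (V → V) × V × V // IsDescendantSet (D : Set V) s} =
      Nat.card {s // IsDescendantSet (Set.range (inl : {x // x ∈ D} → _ ⊕ {x // x ∉ D})) s} :=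
    (Nat.card_congr ((e.conj.prodCongr (e.prodCongr e)).subtypeEquiv fun s =>
      he ▸ (IsDescendantSet.conj e (Set.range inl) s).symm)).symm
  rw [h, card_isDescendantSet_sum, card_rootedTree, card_rootedTree, Nat.card_eq_fintype_card, hc,
    Fintype.card_coe, ← pow_succ, Nat.sub_add_cancel (by omega)]

/-- The number of triples consisting of a rooted tree, given by its parent function, its root `t`
and a vertex `r ≠ t` with exactly `k` descendants. -/
theorem card_descendants_eq (n k : ℕ) (hk : 1 ≤ k) (hkn : k < n) :
    Nat.card {s : (Fin n → Fin n) × Fin n × Fin n // IsParentFun {s.2.2} s.1 ∧ s.2.1 ≠ s.2.2 ∧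
      {x | ∃ m, s.1^[m] x = s.2.1}.ncard = k} =
      n.choose k * (k ^ (k - 1) * (n - k) ^ (n - k)) := by
  classical
  let E : {s : (Fin n → Fin n) × Fin n × Fin n // IsParentFun {s.2.2} s.1 ∧ s.2.1 ≠ s.2.2 ∧
      {x | ∃ m, s.1^[m] x = s.2.1}.ncard = k} ≃
      Σ D : {D : Finset (Fin n) // D.card = k},
        {s : (Fin n → Fin n) × Fin n × Fin n // IsDescendantSet (D.1 : Set (Fin n)) s} :=
    { toFun := fun s => ⟨⟨{x | ∃ m, s.1.1^[m] x = s.1.2.1}.toFinset, by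
          rw [← Set.ncard_eq_toFinset_card']; exact s.2.2.2⟩, s.1, s.2.1, s.2.2.1, by simp⟩
      invFun := fun s => ⟨s.2.1, s.2.2.1, s.2.2.2.1, by
        rw [s.2.2.2.2, Set.ncard_coe_finset, s.1.2]⟩
      left_inv := fun s => rfl
      right_inv := by
        rintro ⟨⟨D, hD⟩, s, h₁, h₂, h₃⟩
        have : D = {x | ∃ m, s.1^[m] x = s.2.1}.toFinset := by
          rw [← Finset.coe_inj, Set.coe_toFinset, h₃]
        subst this
        rfl }
  have hcard : ∀ D : {D : Finset (Fin n) // D.card = k},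
      Nat.card {s : (Fin n → Fin n) × Fin n × Fin n // IsDescendantSet (D.1 : Set (Fin n)) s} =
        k ^ (k - 1) * (n - k) ^ (n - k) := fun D => by
    have hD := D.2
    rw [card_isDescendantSet (Finset.card_pos.1 (by omega)) (by simpa [hD] using hkn), hD,
      Fintype.card_fin]
  rw [Nat.card_congr E, Nat.card_sigma, Finset.sum_congr rfl fun D _ => hcard D, Finset.sum_const,
    Finset.card_univ, Fintype.card_finset_len, Fintype.card_fin, smul_eq_mul]

end Descendants

section TreeOfParentFun

open Function

variable {V : Type*}

/-- The graph joining every vertex to its parent. -/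
def parentGraph (p : V → V) : SimpleGraph V :=
  SimpleGraph.fromRel fun x y => p x = y

theorem parentGraph_adj {p : V → V} {x : V} (hx : x ≠ p x) : (parentGraph p).Adj x (p x) :=
  ⟨hx, Or.inl rfl⟩

theorem IsParentFun.exists_depth {t : V} {p : V → V} (hp : IsParentFun {t} p) :
    ∃ d : V → ℕ, d t = 0 ∧ ∀ x, x ≠ t → d x = d (p x) + 1 := by
  classical
  have h : ∀ x, ∃ m, p^[m] x = t := fun x => by simpa using hp.2 x
  refine ⟨fun x => Nat.find (h x), by simp, fun x hx => ?_⟩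
  exact Nat.find_comp_succ (h x) (h (p x)) hx

variable {p : V → V} {t : V} {d : V → ℕ}

theorem depth_of_adj (hd : ∀ x, x ≠ t → d x = d (p x) + 1) (ht : p t = t) {x y : V}
    (h : (parentGraph p).Adj x y) :
    (x ≠ t ∧ y = p x ∧ d x = d y + 1) ∨ (y ≠ t ∧ x = p y ∧ d y = d x + 1) := by
  obtain ⟨hne, h | h⟩ := h
  · have hx : x ≠ t := by rintro rfl; exact hne (ht.symm.trans h)
    exact Or.inl ⟨hx, h.symm, h ▸ hd x hx⟩
  · have hy : y ≠ t := by rintro rfl; exact hne (h.symm.trans ht)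
    exact Or.inr ⟨hy, h.symm, h ▸ hd y hy⟩

theorem depth_le_add_length (hd : ∀ x, x ≠ t → d x = d (p x) + 1) (ht : p t = t) {x y : V}
    (w : (parentGraph p).Walk x y) : d x ≤ d y + w.length := by
  induction w with
  | nil => simp
  | cons h w ih =>
    rw [SimpleGraph.Walk.length_cons]
    rcases depth_of_adj hd ht h with ⟨_, _, h⟩ | ⟨_, _, h⟩ <;> omega

theorem exists_iterate_of_length_add_depth_le (hd : ∀ x, x ≠ t → d x = d (p x) + 1) (ht : p t = t)
    {x y : V} (w : (parentGraph p).Walk x y) (hw : w.length + d y ≤ d x) :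
    ∃ m, p^[m] x = y := by
  induction w with
  | nil => exact ⟨0, rfl⟩
  | cons h w ih =>
    have hle := depth_le_add_length hd ht w
    rw [SimpleGraph.Walk.length_cons] at hw
    rcases depth_of_adj hd ht h with ⟨_, rfl, h⟩ | ⟨_, _, h⟩
    · obtain ⟨m, hm⟩ := ih (by omega)
      exact ⟨m + 1, hm⟩
    · omega

theorem exists_walk_iterate (p : V → V) (m : ℕ) (x : V) :
    ∃ w : (parentGraph p).Walk x (p^[m] x), w.length ≤ m := by
  induction m generalizing x with
  | zero => exact ⟨.nil, le_rfl⟩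
  | succ m ih =>
    obtain ⟨w, hw⟩ := ih (p x)
    by_cases hx : x = p x
    · exact ⟨w.copy hx.symm rfl, by simp; omega⟩
    · exact ⟨.cons (parentGraph_adj hx) w, by simpa using hw⟩

theorem exists_iterate_depth_eq (h₀ : d t = 0) (hd : ∀ x, x ≠ t → d x = d (p x) + 1) (x : V) :
    p^[d x] x = t := by
  induction h : d x generalizing x with
  | zero =>
    by_contra hx
    have := hd x hx
    omega
  | succ m ih =>
    have hx : x ≠ t := by rintro rfl; omega
    exact ih (p x) (by have := hd x hx; omega)

theorem connected_parentGraph (hp : IsParentFun {t} p) : (parentGraph p).Connected := by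
  have h : ∀ x, (parentGraph p).Reachable x t := fun x => by
    obtain ⟨m, hm⟩ := hp.2 x
    rw [← Finset.mem_singleton.1 hm]
    exact ⟨(exists_walk_iterate p m x).choose⟩
  exact (SimpleGraph.connected_iff _).2 ⟨fun x y => (h x).trans (h y).symm, ⟨t⟩⟩

theorem dist_parentGraph (hp : IsParentFun {t} p) (h₀ : d t = 0)
    (hd : ∀ x, x ≠ t → d x = d (p x) + 1) (x : V) : (parentGraph p).dist x t = d x := by
  have ht := hp.1 t (Finset.mem_singleton_self t)
  refine le_antisymm ?_ ?_
  · obtain ⟨w, hw⟩ := exists_walk_iterate p (d x) x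
    have := (SimpleGraph.dist_le w).trans hw
    rwa [exists_iterate_depth_eq h₀ hd] at this
  · obtain ⟨w, hw⟩ := (connected_parentGraph hp).exists_walk_length_eq_dist x t
    have := depth_le_add_length hd ht w
    omega

theorem isTree_parentGraph [Finite V] (hp : IsParentFun {t} p) : (parentGraph p).IsTree := by
  have ht := hp.1 t (Finset.mem_singleton_self t)
  have hc := connected_parentGraph hp
  refine SimpleGraph.isTree_iff_connected_and_card.2
    ⟨hc, le_antisymm ?_ hc.card_vert_le_card_edgeSet_add_one⟩
  have hsub : (parentGraph p).edgeSet ⊆ (fun x => s(x, p x)) '' ({t}ᶜ : Set V) := by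
    intro e
    induction e with | h x y => ?_
    rintro ⟨hne, h | h⟩
    · exact ⟨x, by rintro rfl; exact hne (ht.symm.trans h), by simp [h]⟩
    · exact ⟨y, by rintro rfl; exact hne (h.symm.trans ht), by simp [h, Sym2.eq_swap]⟩
  have h₁ := (Set.ncard_le_ncard hsub (Set.toFinite _)).trans (Set.ncard_image_le (Set.toFinite _))
  have h₂ := Set.ncard_add_ncard_compl {t}
  rw [Set.ncard_singleton] at h₂
  rw [Nat.card_coe_set_eq]
  omega

theorem dist_eq_add_iff_exists_iterate (hp : IsParentFun {t} p) {x r : V} :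
    (parentGraph p).dist x t = (parentGraph p).dist x r + (parentGraph p).dist r t ↔
      ∃ m, p^[m] x = r := by
  have ht := hp.1 t (Finset.mem_singleton_self t)
  obtain ⟨d, h₀, hd⟩ := hp.exists_depth
  have hc := connected_parentGraph hp
  constructor
  · intro h
    obtain ⟨w, hw⟩ := hc.exists_walk_length_eq_dist x r
    rw [dist_parentGraph hp h₀ hd, dist_parentGraph hp h₀ hd] at h
    exact exists_iterate_of_length_add_depth_le hd ht w (by omega)
  · rintro ⟨m, rfl⟩
    refine le_antisymm hc.dist_triangle ?_
    induction m generalizing x with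
    | zero => simp
    | succ m ih =>
      by_cases hx : x = t
      · rw [hx, iterate_fixed ht]; simp
      · have hadj : (parentGraph p).Adj x (p x) :=
          parentGraph_adj fun h => by have := hd x hx; rw [← h] at this; omega
        have h₁ := hc.dist_triangle (u := x) (v := p x) (w := p^[m] (p x))
        have h₂ := ih (x := p x)
        have h₃ := hd x hx
        rw [SimpleGraph.dist_eq_one_iff_adj.2 hadj] at h₁
        rw [iterate_succ_apply]
        rw [dist_parentGraph hp h₀ hd (p x)] at h₂
        rw [dist_parentGraph hp h₀ hd x]
        omega

theorem parentGraph_inj {q : V → V} (hp : IsParentFun {t} p) (hq : IsParentFun {t} q)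
    (h : parentGraph p = parentGraph q) : p = q := by
  have htp := hp.1 t (Finset.mem_singleton_self t)
  have htq := hq.1 t (Finset.mem_singleton_self t)
  obtain ⟨d, h₀, hd⟩ := hp.exists_depth
  obtain ⟨e, e₀, he⟩ := hq.exists_depth
  have hde : d = e := funext fun x => by
    rw [← dist_parentGraph hp h₀ hd, ← dist_parentGraph hq e₀ he, h]
  subst hde
  funext x
  by_cases hx : x = t
  · rw [hx, htp, htq]
  · have hlt := hd x hx
    have hadj : (parentGraph p).Adj x (p x) :=
      parentGraph_adj fun h => by rw [← h] at hlt; omega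
    rw [h] at hadj
    rcases depth_of_adj he htq hadj with ⟨_, h, _⟩ | ⟨_, _, h⟩
    · exact h
    · omega

theorem exists_parentGraph_eq {T : SimpleGraph V} (hT : T.IsTree) (t : V) :
    ∃ p, IsParentFun {t} p ∧ parentGraph p = T := by
  classical
  have hc := hT.connected
  have h : ∀ x, ∃ y, if x = t then y = t else T.Adj x y ∧ T.dist y t < T.dist x t := fun x => by
    by_cases hx : x = t
    · exact ⟨t, by simp [hx]⟩
    · obtain ⟨w, hw⟩ := hc.exists_walk_length_eq_dist x t
      cases w with
      | nil => exact absurd rfl hx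
      | cons h w =>
        rw [SimpleGraph.Walk.length_cons] at hw
        have := SimpleGraph.dist_le w
        exact ⟨_, by rw [if_neg hx]; exact ⟨h, by omega⟩⟩
  choose p hp using h
  have hpt : p t = t := by simpa using hp t
  have hpx : ∀ x, x ≠ t → T.Adj x (p x) ∧ T.dist (p x) t < T.dist x t := fun x hx => by
    simpa [hx] using hp x
  have hreach : ∀ (n : ℕ) (x : V), T.dist x t = n → ∃ m, p^[m] x = t := by
    intro n
    induction n using Nat.strong_induction_on with
    | _ n ih =>
      intro x hx
      by_cases hxt : x = t
      · exact ⟨0, hxt⟩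
      · obtain ⟨m, hm⟩ := ih _ (hx ▸ (hpx x hxt).2) (p x) rfl
        exact ⟨m + 1, hm⟩
  have hpar : IsParentFun {t} p :=
    ⟨by simpa using hpt, fun x => by simpa using hreach _ x rfl⟩
  refine ⟨p, hpar, ?_⟩
  have hle : parentGraph p ≤ T := by
    have : ∀ x, x ≠ p x → T.Adj x (p x) := fun x hx =>
      (hpx x (by rintro rfl; exact hx hpt.symm)).1
    rintro x y ⟨hne, rfl | rfl⟩
    · exact this x hne
    · exact (this y hne.symm).symm
  exact ((SimpleGraph.isTree_iff_minimal_connected.1 hT).eq_of_le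
    (connected_parentGraph hpar) hle)

theorem card_doublyRootedTree_eq [Finite V] (k : ℕ) :
    Nat.card {s : SimpleGraph V × V × V // (s.1.Connected ∧ s.1.IsAcyclic) ∧ s.2.1 ≠ s.2.2 ∧
      {x : V | s.1.dist x s.2.2 = s.1.dist x s.2.1 + s.1.dist s.2.1 s.2.2}.ncard = k} =
    Nat.card {s : (V → V) × V × V // IsParentFun {s.2.2} s.1 ∧ s.2.1 ≠ s.2.2 ∧
      {x | ∃ m, s.1^[m] x = s.2.1}.ncard = k} := by
  have hset : ∀ (p : V → V) (r t : V), IsParentFun {t} p →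
      {x | (parentGraph p).dist x t = (parentGraph p).dist x r + (parentGraph p).dist r t} =
        {x | ∃ m, p^[m] x = r} := fun p r t hp => Set.ext fun x =>
    dist_eq_add_iff_exists_iterate hp
  refine (Nat.card_eq_of_bijective (fun s => ⟨(parentGraph s.1.1, s.1.2),
    ⟨(isTree_parentGraph s.2.1).connected, (isTree_parentGraph s.2.1).isAcyclic⟩, s.2.2.1,
    (congrArg Set.ncard (hset _ _ _ s.2.1)).trans s.2.2.2⟩) ⟨?_, ?_⟩).symm
  · rintro ⟨⟨p, r, t⟩, hp, _⟩ ⟨⟨q, r', t'⟩, hq, _⟩ h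
    simp only [Subtype.mk.injEq, Prod.mk.injEq] at h
    obtain ⟨h, rfl, rfl⟩ := h
    obtain rfl := parentGraph_inj hp hq h
    rfl
  · rintro ⟨⟨T, r, t⟩, ⟨hc, ha⟩, hne, hk⟩
    obtain ⟨p, hp, rfl⟩ := exists_parentGraph_eq ⟨hc, ha⟩ t
    exact ⟨⟨(p, r, t), hp, hne, by rw [← hset _ _ _ hp]; exact hk⟩, rfl⟩

end TreeOfParentFun

section Limit

open Filter Topology

theorem tendsto_choose_div_pow (k : ℕ) :
    Tendsto (fun n : ℕ => (n.choose k : ℝ) / (n : ℝ) ^ k) atTop (𝓝 (1 / k.factorial)) := by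
  have h := (Asymptotics.isEquivalent_iff_tendsto_one ?_).1 (isEquivalent_choose k)
  · refine (h.mul_const (1 / (k.factorial : ℝ))).congr' ?_ |>.trans (by simp)
    filter_upwards [eventually_gt_atTop 0] with n hn
    have : (n : ℝ) ≠ 0 := by positivity
    simp only [Pi.div_apply]
    field_simp
  · filter_upwards [eventually_gt_atTop 0] with n hn
    positivity

theorem tendsto_borel (k : ℕ) :
    Tendsto (fun n : ℕ =>
      ((n.choose k * (k ^ (k - 1) * (n - k) ^ (n - k)) : ℕ) : ℝ) /
        (((n : ℝ) - 1) * (n : ℝ) ^ (n - 1))) atTop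
      (𝓝 ((k : ℝ) ^ (k - 1) / k.factorial * Real.exp (-(k : ℝ)))) := by
  have h₁ := tendsto_choose_div_pow k
  have h₂ := Real.tendsto_one_add_div_pow_exp (-(k : ℝ))
  have h₀ : ∀ c : ℝ, Tendsto (fun n : ℕ => 1 + c / (n : ℝ)) atTop (𝓝 1) := fun c => by
    simpa using (tendsto_const_div_atTop_nhds_zero_nat c).const_add 1
  have h₃ := ((h₀ (-(k : ℝ))).pow k).inv₀ (by simp)
  have h₄ := (h₀ (-1)).inv₀ one_ne_zero
  have h := (((h₁.const_mul ((k : ℝ) ^ (k - 1))).mul h₂).mul h₃).mul h₄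
  have hlim : (k : ℝ) ^ (k - 1) * (1 / k.factorial) * Real.exp (-(k : ℝ)) * (1 ^ k)⁻¹ * 1⁻¹ =
      (k : ℝ) ^ (k - 1) / k.factorial * Real.exp (-(k : ℝ)) := by
    simp [div_eq_mul_inv]
  rw [hlim] at h
  refine h.congr' ?_
  filter_upwards [eventually_gt_atTop (k + 1)] with n hn
  obtain ⟨m, rfl⟩ := Nat.exists_eq_add_of_lt (show k < n by omega)
  have hm : k + m + 1 - k = m + 1 := by omega
  have hm₀ : (m : ℝ) + 1 ≠ 0 := by positivity
  have hn₀ : (k : ℝ) + m + 1 ≠ 0 := by positivity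
  have hn₁ : (k : ℝ) + m ≠ 0 := by
    have : 0 < k + m := by omega
    exact_mod_cast this.ne'
  have e₁ : 1 + -(k : ℝ) / ((k + m + 1 : ℕ) : ℝ) = (m + 1) / (k + m + 1) := by
    push_cast; field_simp; ring
  have e₂ : 1 + -1 / ((k + m + 1 : ℕ) : ℝ) = (k + m) / (k + m + 1) := by
    push_cast; field_simp; ring
  rw [e₁, e₂, hm, Nat.add_sub_cancel]
  push_cast
  rw [show (k : ℝ) + m + 1 - 1 = k + m by ring, div_pow, div_pow]
  have e₃ : ((m : ℝ) + 1) ^ (k + m + 1) = (m + 1) ^ (m + 1) * (m + 1) ^ k := by ring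
  rw [e₃, pow_succ ((k : ℝ) + m + 1) (k + m)]
  field_simp

end Limit

/-- Fix `k ≥ 1`.  As `n → ∞`, the proportion of doubly rooted trees `(T, r, t)` on
the vertex set `{1, …, n}` whose root component has exactly `k` vertices, among all
`(n-1) * n^(n-1)` doubly rooted trees, converges to `(k^(k-1) / k!) * e^(-k)`.
The root component of `(T, r, t)` is the set of vertices `x` with
`dist T x t = dist T x r + dist T r t`. -/
theorem root_component_size_limit_borel (k : ℕ) (hk : 1 ≤ k) :
    Filter.Tendsto (fun n : ℕ =>
      (Nat.card {p : SimpleGraph (Fin n) × Fin n × Fin n //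
          (p.1.Connected ∧ p.1.IsAcyclic) ∧ p.2.1 ≠ p.2.2 ∧
          {x : Fin n |
            p.1.dist x p.2.2 = p.1.dist x p.2.1 + p.1.dist p.2.1 p.2.2}.ncard = k} : ℝ) /
        (((n : ℝ) - 1) * (n : ℝ) ^ (n - 1)))
      Filter.atTop
      (nhds ((k : ℝ) ^ (k - 1) / k.factorial * Real.exp (-(k : ℝ)))) := by
  refine (tendsto_borel k).congr' ?_
  filter_upwards [Filter.eventually_gt_atTop k] with n hn
  rw [card_doublyRootedTree_eq, card_descendants_eq n k hk hn]
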